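/- arXiv:2307.03991 — 5 statements merged into one kernel-verified Lean document; each statement's English description precedes it below -/
import Mathlib

section
/- For all integers m, n ≥ 1, the rational functions χ_N satisfy the shuffle relation Σ_{τ ∈ Sh(m,n)} χ_{m+n}(x_{τ⁻¹(1)}, x_{τ⁻¹(2)}, …, x_{τ⁻¹(m+n)}) = χ_m(x₁, …, x_m) · χ_n(x_{m+1}, …, x_{m+n}) in the field K = ℚ(x₁, x₂, …). -/
noncomputable section

/-- The field `K = ℚ(x₁, x₂, …)`, the fraction field of the polynomial ring over `ℚ`
in countably many indeterminates. -/
abbrev K : Type := FractionRing (MvPolynomial ℕ ℚ)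

/-- The variable `xᵢ` (0-indexed), viewed as an element of `K`. -/
def xK (i : ℕ) : K :=
  algebraMap (MvPolynomial ℕ ℚ) K (MvPolynomial.X i)

/-- `chi F N v = χ_N(v₁, …, v_N)`, with 0-indexed arguments `v 0, …, v (N-1)`:
`χ_N(v₁,…,v_N) = (v₁ (v₂ − v₁) ⋯ (v_N − v_{N−1}) (1 − v_N))⁻¹`. -/
def chi (F : Type*) [Field F] (N : ℕ) (v : ℕ → F) : F :=
  (v 0 * (∏ j ∈ Finset.range (N - 1), (v (j + 1) - v j)) * (1 - v (N - 1)))⁻¹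

/-- An `(m,n)`-shuffle (0-indexed): a permutation of `{0, …, m+n−1}` that is
(strictly) increasing on the first `m` letters and on the last `n` letters. -/
def IsShuffle (m n : ℕ) (τ : Equiv.Perm (Fin (m + n))) : Prop :=
  (∀ i j : Fin (m + n), (i : ℕ) < (j : ℕ) → (j : ℕ) < m → τ i < τ j) ∧
  (∀ i j : Fin (m + n), (i : ℕ) < (j : ℕ) → m ≤ (i : ℕ) → τ i < τ j)

/-- The finset of all interleavings of two lists. -/
def shuffleList {α : Type*} [DecidableEq α] : List α → List α → Finset (List α)
  | [], v => {v}
  | u, [] => {u}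
  | b :: u, c :: v =>
    (shuffleList u (c :: v)).image (List.cons b) ∪ (shuffleList (b :: u) v).image (List.cons c)
termination_by u v => u.length + v.length

theorem mem_shuffleList {α : Type*} [DecidableEq α] (p : α → Bool) (l u v : List α)
    (hu : ∀ i ∈ u, p i = true) (hv : ∀ i ∈ v, p i = false) :
    l ∈ shuffleList u v ↔ l.filter p = u ∧ l.filter (fun i => !p i) = v := by
  induction l generalizing u v with
  | nil =>
    cases u <;> cases v <;> simp [shuffleList]
  | cons d l ih =>
    rcases u with _ | ⟨b, u⟩
    · simp only [shuffleList, Finset.mem_singleton]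
      constructor
      · rintro rfl
        refine ⟨List.filter_eq_nil_iff.2 fun i hi => by simp [hv i hi],
          List.filter_eq_self.2 fun i hi => by simp [hv i hi]⟩
      · rintro ⟨h1, h2⟩
        rw [← h2]
        refine (List.filter_eq_self.2 fun i hi => ?_).symm
        simpa using List.filter_eq_nil_iff.1 h1 i hi
    rcases v with _ | ⟨c, v⟩
    · simp only [shuffleList, Finset.mem_singleton]
      constructor
      · intro h
        rw [h]
        refine ⟨List.filter_eq_self.2 hu,
          List.filter_eq_nil_iff.2 fun i hi => by simp [hu i hi]⟩
      · rintro ⟨h1, h2⟩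
        rw [← h1]
        refine (List.filter_eq_self.2 fun i hi => ?_).symm
        simpa using List.filter_eq_nil_iff.1 h2 i hi
    have hb := hu b (by simp)
    have hc := hv c (by simp)
    have ih1 := ih u (c :: v) (fun i hi => hu i (by simp [hi])) hv
    have ih2 := ih (b :: u) v hu (fun i hi => hv i (by simp [hi]))
    simp only [shuffleList, Finset.mem_union, Finset.mem_image, List.cons.injEq]
    rcases hd : p d with _ | _
    · have hdb : b ≠ d := by rintro rfl; simp_all
      simp only [List.filter_cons, hd, hdb, false_and, and_false, exists_false, false_or]
      simp only [Bool.false_eq_true, if_false, Bool.not_false, if_true, List.cons.injEq]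
      constructor
      · rintro ⟨l', h, rfl, rfl⟩
        have := ih2.1 h
        exact ⟨this.1, rfl, this.2⟩
      · rintro ⟨h1, rfl, h2⟩
        exact ⟨l, ih2.2 ⟨h1, h2⟩, rfl, rfl⟩
    · have hdc : c ≠ d := by rintro rfl; simp_all
      simp only [List.filter_cons, hd, hdc, false_and, and_false, exists_false, or_false]
      simp only [Bool.false_eq_true, if_false, Bool.not_true, if_true, List.cons.injEq]
      constructor
      · rintro ⟨l', h, rfl, rfl⟩
        have := ih1.1 h
        exact ⟨⟨rfl, this.1⟩, this.2⟩
      · rintro ⟨⟨rfl, h1⟩, h2⟩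
        exact ⟨l, ih1.2 ⟨h1, h2⟩, rfl, rfl⟩

/-- The function `((v₁ - a) (v₂ - v₁) ⋯ (v_N - v_{N-1}) (1 - v_N))⁻¹` of the list `v`. -/
def chainInv {F : Type*} [Field F] : F → List F → F
  | a, [] => (1 - a)⁻¹
  | a, b :: l => (b - a)⁻¹ * chainInv b l

theorem chainInv_ofFn {F : Type*} [Field F] (k : ℕ) (a : F) (v : ℕ → F) :
    chainInv a (List.ofFn fun j : Fin (k + 1) => v j) =
      ((v 0 - a) * (∏ j ∈ Finset.range k, (v (j + 1) - v j)) * (1 - v k))⁻¹ := by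
  induction k generalizing a v with
  | zero => simp [chainInv, mul_comm]
  | succ k ih =>
    have := ih (v 0) (fun j => v (j + 1))
    rw [List.ofFn_succ, chainInv]
    simp only [Fin.val_succ, Fin.val_zero]
    rw [this, Finset.prod_range_succ', ← mul_inv]
    congr 1
    ring

theorem chi_eq_chainInv {F : Type*} [Field F] (N : ℕ) (hN : 1 ≤ N) (v : ℕ → F) :
    chi F N v = chainInv 0 (List.ofFn fun j : Fin N => v j) := by
  obtain ⟨k, rfl⟩ := Nat.exists_eq_add_of_le' hN
  rw [chainInv_ofFn, sub_zero, chi, Nat.add_sub_cancel]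

theorem sum_chainInv_shuffleList {α F : Type*} [DecidableEq α] [Field F] (X : α → F)
    (hX : Function.Injective X) (hX1 : ∀ i, X i ≠ 1) (u v : List α) (huv : (u ++ v).Nodup)
    (a : F) (ha1 : a ≠ 1) (ha : ∀ i ∈ u ++ v, X i ≠ a) :
    ∑ l ∈ shuffleList u v, chainInv a (l.map X) =
      chainInv a (u.map X) * chainInv a (v.map X) * (1 - a) := by
  have ha1' : 1 - a ≠ 0 := sub_ne_zero.2 ha1.symm
  induction u, v using shuffleList.induct generalizing a with
  | case1 v => simp [shuffleList, chainInv]; field_simp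
  | case2 u hu =>
    cases u with
    | nil => exact absurd rfl hu
    | cons b u => simp [shuffleList, chainInv]; field_simp
  | case3 b u c v ih1 ih2 =>
    have hbc : b ≠ c := by rintro rfl; simp at huv
    have hba : X b - a ≠ 0 := sub_ne_zero.2 (ha b (by simp))
    have hca : X c - a ≠ 0 := sub_ne_zero.2 (ha c (by simp))
    have hcb : X c - X b ≠ 0 := sub_ne_zero.2 (hX.ne hbc.symm)
    have hbc' : X b - X c ≠ 0 := sub_ne_zero.2 (hX.ne hbc)
    have hdis : Disjoint ((shuffleList u (c :: v)).image (List.cons b))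
        ((shuffleList (b :: u) v).image (List.cons c)) := by
      rw [Finset.disjoint_left]
      simp only [Finset.mem_image, not_exists, not_and]
      rintro _ ⟨l, -, rfl⟩ l' - h
      exact hbc (List.cons.inj h).1.symm
    have huv' : (c :: ((b :: u) ++ v)).Nodup := (List.perm_middle.nodup_iff).1 huv
    rw [List.cons_append, List.nodup_cons] at huv
    rw [List.nodup_cons] at huv'
    rw [shuffleList, Finset.sum_union hdis, Finset.sum_image (by simp), Finset.sum_image (by simp)]
    simp only [List.map_cons, chainInv, ← Finset.mul_sum]
    rw [ih1 huv.2 (X b) (hX1 b) (fun i hi h => huv.1 (hX h ▸ hi)) (sub_ne_zero.2 (hX1 b).symm),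
      ih2 huv'.2 (X c) (hX1 c) (fun i hi h => huv'.1 (hX h ▸ hi)) (sub_ne_zero.2 (hX1 c).symm)]
    simp only [List.map_cons, chainInv]
    field_simp
    ring

theorem xK_injective : Function.Injective xK :=
  (IsFractionRing.injective (MvPolynomial ℕ ℚ) K).comp (MvPolynomial.X_injective)

theorem xK_ne_zero (i : ℕ) : xK i ≠ 0 := by
  rw [xK, Ne, IsFractionRing.to_map_eq_zero_iff]
  exact MvPolynomial.X_ne_zero i

theorem xK_ne_one (i : ℕ) : xK i ≠ 1 := by
  intro h
  rw [xK, ← map_one (algebraMap (MvPolynomial ℕ ℚ) K)] at h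
  have h := congrArg (MvPolynomial.eval fun _ => (0 : ℚ))
    (IsFractionRing.injective (MvPolynomial ℕ ℚ) K h)
  simp at h

/-- The one-line word `τ⁻¹(0), τ⁻¹(1), …` of the inverse of a permutation. -/
def invWord {N : ℕ} (τ : Equiv.Perm (Fin N)) : List ℕ :=
  List.ofFn fun j => ((τ⁻¹ j : Fin N) : ℕ)

theorem invWord_injective {N : ℕ} : Function.Injective (invWord (N := N)) := by
  intro σ τ h
  have h := List.ofFn_injective h
  apply inv_injective
  ext j
  exact congrFun h j

theorem mem_invWord {N : ℕ} (τ : Equiv.Perm (Fin N)) (i : ℕ) : i ∈ invWord τ ↔ i < N := by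
  simp only [invWord, List.mem_ofFn]
  constructor
  · rintro ⟨j, rfl⟩
    exact (τ⁻¹ j).2
  · intro h
    exact ⟨τ ⟨i, h⟩, by simp⟩

theorem exists_invWord_eq {N : ℕ} {l : List ℕ} (h : l.Perm (List.range N)) :
    ∃ τ : Equiv.Perm (Fin N), invWord τ = l := by
  have hlen : l.length = N := by simpa using h.length_eq
  have hnd : l.Nodup := h.nodup_iff.2 List.nodup_range
  subst hlen
  let f : Fin l.length → Fin l.length :=
    fun j => ⟨l[j], List.mem_range.1 (h.mem_iff.1 (List.getElem_mem j.2))⟩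
  have hf : Function.Injective f := by
    intro i j hij
    exact Fin.ext ((hnd.getElem_inj_iff).1 (congrArg Fin.val hij))
  refine ⟨(Equiv.ofBijective f (Finite.injective_iff_bijective.1 hf))⁻¹, ?_⟩
  simp [invWord, f]

theorem pairwise_filter_invWord {N : ℕ} (p : ℕ → Bool) (τ : Equiv.Perm (Fin N)) :
    ((invWord τ).filter p).Pairwise (· < ·) ↔
      ∀ i j : Fin N, i < j → p i = true → p j = true → τ i < τ j := by
  simp only [List.pairwise_filter, invWord, List.pairwise_ofFn, ← Fin.lt_def]
  refine ⟨fun h i j hij hi hj => ?_, fun h a b hab ha hb => ?_⟩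
  · by_contra hlt
    have hji := h (lt_of_le_of_ne (not_lt.1 hlt) (τ.injective.ne hij.ne'))
    simp only [← Equiv.Perm.mul_apply, inv_mul_cancel, Equiv.Perm.one_apply] at hji
    exact (hji hj hi).asymm hij
  · by_contra hlt
    have hba := h (τ⁻¹ b) (τ⁻¹ a) (lt_of_le_of_ne (not_lt.1 hlt) (τ⁻¹.injective.ne hab.ne')) hb ha
    simp only [← Equiv.Perm.mul_apply, mul_inv_cancel, Equiv.Perm.one_apply] at hba
    exact hba.asymm hab

theorem isShuffle_iff_pairwise (m n : ℕ) (τ : Equiv.Perm (Fin (m + n))) :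
    IsShuffle m n τ ↔
      ((invWord τ).filter fun i => decide (i < m)).Pairwise (· < ·) ∧
      ((invWord τ).filter fun i => !decide (i < m)).Pairwise (· < ·) := by
  simp only [pairwise_filter_invWord, IsShuffle, decide_eq_true_eq, Bool.not_eq_true',
    decide_eq_false_iff_not, not_lt, Fin.lt_def (n := m + n)]
  exact and_congr
    ⟨fun h i j hij _ hj => h i j hij hj, fun h i j hij hj => h i j hij (hij.trans hj) hj⟩
    ⟨fun h i j hij hi _ => h i j hij hi, fun h i j hij hi => h i j hij hi (hi.trans hij.le)⟩

theorem List.eq_of_pairwise_lt_of_mem_iff {l₁ l₂ : List ℕ} (h₁ : l₁.Pairwise (· < ·))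
    (h₂ : l₂.Pairwise (· < ·)) (h : ∀ i, i ∈ l₁ ↔ i ∈ l₂) : l₁ = l₂ :=
  ((List.perm_ext_iff_of_nodup (h₁.imp ne_of_lt) (h₂.imp ne_of_lt)).2 h).eq_of_pairwise
    (fun _ _ _ _ hab hba => absurd hab hba.asymm) h₁ h₂

theorem pairwise_lt_map_add_range (m n : ℕ) :
    ((List.range n).map (m + ·)).Pairwise (· < ·) := by
  rw [List.pairwise_map]
  exact List.pairwise_lt_range.imp fun h => by omega

theorem isShuffle_iff_invWord_mem (m n : ℕ) (τ : Equiv.Perm (Fin (m + n))) :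
    IsShuffle m n τ ↔
      invWord τ ∈ shuffleList (List.range m) ((List.range n).map (m + ·)) := by
  rw [isShuffle_iff_pairwise, mem_shuffleList (fun i => decide (i < m)) _ _ _ (by simp) (by simp)]
  constructor
  · rintro ⟨h1, h2⟩
    refine ⟨List.eq_of_pairwise_lt_of_mem_iff h1 List.pairwise_lt_range fun i => ?_,
      List.eq_of_pairwise_lt_of_mem_iff h2 (pairwise_lt_map_add_range m n) fun i => ?_⟩
    · simp only [List.mem_filter, mem_invWord, decide_eq_true_eq, List.mem_range]
      omega
    · simp only [List.mem_filter, mem_invWord, Bool.not_eq_true', decide_eq_false_iff_not,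
        List.mem_map, List.mem_range]
      exact ⟨fun h => ⟨i - m, by omega, by omega⟩, by rintro ⟨j, hj, rfl⟩; omega⟩
  · rintro ⟨h1, h2⟩
    rw [h1, h2]
    exact ⟨List.pairwise_lt_range, pairwise_lt_map_add_range m n⟩

theorem perm_range_of_mem_shuffleList {m n : ℕ} {l : List ℕ}
    (h : l ∈ shuffleList (List.range m) ((List.range n).map (m + ·))) :
    l.Perm (List.range (m + n)) := by
  rw [mem_shuffleList (fun i => decide (i < m)) _ _ _ (by simp) (by simp)] at h
  rw [List.range_add, ← h.1, ← h.2]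
  exact (List.filter_append_perm _ l).symm

open scoped Classical in
/-- Proposition (shuffle relations): for `m, n ≥ 1`,
`Σ_{τ ∈ Sh(m,n)} χ_{m+n}(x_{τ⁻¹(1)}, …, x_{τ⁻¹(m+n)})
  = χ_m(x₁, …, x_m) · χ_n(x_{m+1}, …, x_{m+n})` in `K = ℚ(x₁, x₂, …)`. -/
theorem chi_shuffle_relation (m n : ℕ) (hm : 1 ≤ m) (hn : 1 ≤ n) :
    ∑ τ ∈ Finset.univ.filter (fun τ : Equiv.Perm (Fin (m + n)) => IsShuffle m n τ),
        chi K (m + n)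
          (fun j => if h : j < m + n then xK ((τ⁻¹ ⟨j, h⟩ : Fin (m + n)) : ℕ) else 0)
      = chi K m (fun j => xK j) * chi K n (fun j => xK (m + j)) := by
  have hchi : ∀ τ : Equiv.Perm (Fin (m + n)),
      chi K (m + n)
          (fun j => if h : j < m + n then xK ((τ⁻¹ ⟨j, h⟩ : Fin (m + n)) : ℕ) else 0)
        = chainInv 0 ((invWord τ).map xK) := by
    intro τ
    rw [chi_eq_chainInv _ (by omega), invWord, List.map_ofFn]
    congr 2
    ext j
    simp
  have hu : List.ofFn (fun j : Fin m => xK j) = (List.range m).map xK := by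
    rw [List.ofFn_eq_map, ← List.map_coe_finRange_eq_range, List.map_map]
    rfl
  have hv : List.ofFn (fun j : Fin n => xK (m + j)) = ((List.range n).map (m + ·)).map xK := by
    rw [List.ofFn_eq_map, ← List.map_coe_finRange_eq_range, List.map_map, List.map_map]
    rfl
  have hnd : (List.range m ++ (List.range n).map (m + ·)).Nodup := by
    rw [← List.range_add]
    exact List.nodup_range
  have key := sum_chainInv_shuffleList xK xK_injective xK_ne_one (List.range m)
    ((List.range n).map (m + ·)) hnd 0 zero_ne_one fun i _ => xK_ne_zero i
  rw [chi_eq_chainInv m hm, chi_eq_chainInv n hn, hu, hv]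
  rw [sub_zero, mul_one] at key
  rw [← key]
  refine Finset.sum_nbij invWord (fun τ hτ => ?_) invWord_injective.injOn (fun l hl => ?_)
    fun τ _ => hchi τ
  · exact (isShuffle_iff_invWord_mem m n τ).1 (Finset.mem_filter.1 hτ).2
  · obtain ⟨τ, rfl⟩ := exists_invWord_eq (perm_range_of_mem_shuffleList hl)
    exact ⟨τ, by simpa using (isShuffle_iff_invWord_mem m n τ).2 hl, rfl⟩
end
end

section
/- Let N ≥ 1 and let x₁,…,x_N be real numbers with 0 < x₁ < x₂ < ⋯ < x_N < 1. Then the family of real numbers x₁^{i₁}·x₂^{i₂}⋯x_N^{i_N} (integer exponents, using zpow since all x_k > 0), indexed by the lattice points (i₁,…,i_N) ∈ 𝒞_N ∩ ℤ^N (i.e. integer vectors all of whose partial sums i₁+⋯+i_j, 1 ≤ j ≤ N, are nonnegative), is summable, and Σ_{(i₁,…,i_N) ∈ 𝒞_N ∩ ℤ^N} x₁^{i₁}⋯x_N^{i_N} = (∏_{k=1}^{N−1} x_{k+1}/(x_{k+1}−x_k)) · (1/(1−x_N)) = x₁⋯x_N · χ_N(x₁,…,x_N). (This computes the lattice-point transform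 Φ(𝒞_N) of the cone 𝒞_N.) -/
noncomputable section

/-- The lattice points of the cone `𝒞_N`: integer vectors all of whose
partial sums `i₁ + ⋯ + i_j` (`1 ≤ j ≤ N`) are nonnegative. -/
def latticeCone (N : ℕ) : Set (Fin N → ℤ) :=
  {f | ∀ j : Fin N, 0 ≤ ∑ k ∈ Finset.Iic j, f k}

/-- An integer vector lies in the cone iff its truncation does and its total sum is nonnegative. -/
theorem snoc_mem_latticeCone_iff {n : ℕ} {f : Fin n → ℤ} {a : ℤ} :
    (Fin.snoc f a : Fin (n + 1) → ℤ) ∈ latticeCone (n + 1) ↔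
      f ∈ latticeCone n ∧ 0 ≤ ∑ k, f k + a := by
  simp only [latticeCone, Set.mem_ofPred_eq, Fin.forall_fin_succ', ← Fin.top_eq_last,
    Finset.Iic_top]
  refine and_congr (forall_congr' fun j => ?_) ?_
  · rw [← Fin.map_castSuccEmb_Iic, Finset.sum_map]
    simp
  · simp [Fin.sum_univ_castSucc]

/-- A lattice point of the cone is determined by its truncation and its total sum. -/
def latticeConeSuccEquiv (n : ℕ) : latticeCone n × ℕ ≃ latticeCone (n + 1) where
  toFun q := ⟨Fin.snoc q.1.1 (q.2 - ∑ k, q.1.1 k),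
    snoc_mem_latticeCone_iff.2 ⟨q.1.2, by simp⟩⟩
  invFun p := (⟨Fin.init p.1, (snoc_mem_latticeCone_iff.1
    ((Fin.snoc_init_self p.1).symm ▸ p.2)).1⟩, (∑ k, p.1 k).toNat)
  left_inv q := by
    ext <;> simp [Fin.sum_univ_castSucc]
  right_inv p := by
    have h : 0 ≤ ∑ k, p.1 k := by
      simpa [← Fin.top_eq_last, Finset.Iic_top] using p.2 (Fin.last n)
    ext1
    conv_rhs => rw [← Fin.snoc_init_self p.1]
    simp only [Int.toNat_of_nonneg h]
    congr 1
    simp [Fin.sum_univ_castSucc, Fin.init]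

theorem zpow_sum_eq_prod {ι K : Type*} [Field K] {a : K} (ha : a ≠ 0) (s : Finset ι) (f : ι → ℤ) :
    a ^ ∑ i ∈ s, f i = ∏ i ∈ s, a ^ f i := by
  classical
  induction s using Finset.induction_on with
  | empty => simp
  | insert i s hi ih => rw [Finset.sum_insert hi, Finset.prod_insert hi, zpow_add₀ ha, ih]

/-- The lattice-point transform of the cone, with `y n = 1` appended to the variables. -/
theorem hasSum_latticeCone (n : ℕ) (y : ℕ → ℝ) (hpos : ∀ k ≤ n, 0 < y k)
    (hlt : ∀ k < n, y k < y (k + 1)) (hn : y n = 1) :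
    HasSum (fun p : latticeCone n => ∏ k : Fin n, y (k : ℕ) ^ (p.1 k))
      (∏ k ∈ Finset.range n, y (k + 1) / (y (k + 1) - y k)) := by
  induction n generalizing y with
  | zero =>
    have : Unique (latticeCone 0) := ⟨⟨⟨0, fun j => j.elim0⟩⟩, fun _ => Subsingleton.elim _ _⟩
    simp
  | succ n ih =>
    have hy : 0 < y n := hpos n n.le_succ
    have hy1 : y n < 1 := hn ▸ hlt n n.lt_succ_self
    have hscaled := ih (fun k => y k / y n) (fun k hk => div_pos (hpos k (by lia)) hy)
      (fun k hk => div_lt_div_of_pos_right (hlt k (by lia)) hy) (div_self hy.ne')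
    have hgeom := hasSum_geometric_of_lt_one hy.le hy1
    have hmul := hscaled.mul hgeom <| hscaled.summable.mul_of_nonneg hgeom.summable
      (fun p => Finset.prod_nonneg fun k _ =>
        zpow_nonneg (div_pos (hpos k (by lia)) hy).le _)
      (fun m => pow_nonneg hy.le m)
    rw [← (latticeConeSuccEquiv n).hasSum_iff]
    convert hmul using 1
    · rfl
    · funext q
      simp only [Function.comp_apply, latticeConeSuccEquiv, Equiv.coe_fn_mk,
        Fin.prod_univ_castSucc, Fin.snoc_castSucc, Fin.snoc_last, Fin.val_castSucc,
        Fin.val_last, div_zpow, Finset.prod_div_distrib, zpow_sub₀ hy.ne', zpow_natCast,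
        zpow_sum_eq_prod hy.ne']
      ring
    · rw [Finset.prod_range_succ, hn, one_div]
      congr 1
      refine Finset.prod_congr rfl fun k _ => ?_
      rw [← sub_div, div_div_div_cancel_right₀ hy.ne']

/-- Computation of the lattice-point transform `Φ(𝒞_N)` of the cone `𝒞_N`:
for `0 < x₁ < x₂ < ⋯ < x_N < 1` (0-indexed: `x 0, …, x (N-1)`), the family
`x₁^{i₁} ⋯ x_N^{i_N}` indexed by `(i₁,…,i_N) ∈ 𝒞_N ∩ ℤ^N` is summable with sum
`(∏_{k=1}^{N−1} x_{k+1}/(x_{k+1} − x_k)) · (1/(1 − x_N)) = x₁⋯x_N · χ_N(x₁,…,x_N)`. -/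
theorem latticePointTransform_cone (N : ℕ) (hN : 1 ≤ N) (x : ℕ → ℝ)
    (h0 : 0 < x 0) (hmono : ∀ k, k + 1 < N → x k < x (k + 1)) (h1 : x (N - 1) < 1) :
    HasSum (fun p : latticeCone N => ∏ k : Fin N, x (k : ℕ) ^ (p.1 k))
        ((∏ k ∈ Finset.range (N - 1), x (k + 1) / (x (k + 1) - x k))
          * (1 / (1 - x (N - 1))))
      ∧ (∏ k ∈ Finset.range (N - 1), x (k + 1) / (x (k + 1) - x k))
            * (1 / (1 - x (N - 1)))
          = (∏ k ∈ Finset.range N, x k) * chi ℝ N x := by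
  obtain ⟨n, rfl⟩ := Nat.exists_eq_add_of_le' hN
  simp only [Nat.add_sub_cancel] at h1 ⊢
  have hpos : ∀ k ≤ n, 0 < x k := by
    intro k hk
    induction k with
    | zero => exact h0
    | succ k ih => exact (ih (by lia)).trans (hmono k (by lia))
  constructor
  · have hy : ∀ k ≤ n, Function.update x (n + 1) 1 k = x k := fun k hk =>
      Function.update_of_ne (by lia) _ _
    have hlast : Function.update x (n + 1) 1 (n + 1) = 1 := Function.update_self _ _ _
    have h := hasSum_latticeCone (n + 1) (Function.update x (n + 1) 1)
      (fun k hk => by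
        rcases Nat.lt_or_eq_of_le hk with hk | rfl
        · rw [hy k (by lia)]; exact hpos k (by lia)
        · rw [hlast]; exact one_pos)
      (fun k hk => by
        rw [hy k (by lia)]
        rcases Nat.lt_or_eq_of_le (Nat.le_of_lt_succ hk) with hk | rfl
        · rw [hy (k + 1) (by lia)]; exact hmono k (by lia)
        · rwa [hlast])
      hlast
    convert h using 1
    · funext p
      exact Finset.prod_congr rfl fun k _ => by rw [hy k (by lia)]
    · rw [Finset.prod_range_succ, hlast, hy n le_rfl]
      congr 1
      refine Finset.prod_congr rfl fun k hk => ?_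
      have := Finset.mem_range.1 hk
      rw [hy k (by lia), hy (k + 1) (by lia)]
  · rw [chi, Nat.add_sub_cancel, Finset.prod_div_distrib, Finset.prod_range_succ', mul_inv,
      mul_inv]
    field_simp
end
end

section
/- For every integer r with 0 ≤ r ≤ N, the product ω₀·ω₁⋯ω̂_r⋯ω_N in the exterior algebra Λ(R^N) (the factor ω_r omitted, the remaining N factors multiplied in increasing order of the index j) equals (−1)^{N−r}·ι(e₁)·ι(e₂)⋯ι(e_N). -/
/-- The vectors `e₀, e₁, …, e_N, e_{N+1}` in `R^N`: `e_j` is the `j`-th standard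
basis vector for `1 ≤ j ≤ N`, and `e₀ = e_{N+1} = 0`. -/
def stdE (R : Type*) [CommRing R] (N : ℕ) (j : ℕ) : Fin N → R :=
  if h : 1 ≤ j ∧ j ≤ N then Pi.single (⟨j - 1, by omega⟩ : Fin N) 1 else 0

/-- `ω_j = ι(e_{j+1}) − ι(e_j)` in the exterior algebra `Λ(R^N)`, `0 ≤ j ≤ N`. -/
def omegaE (R : Type*) [CommRing R] (N : ℕ) (j : ℕ) :
    ExteriorAlgebra R (Fin N → R) :=
  ExteriorAlgebra.ι R (stdE R N (j + 1)) - ExteriorAlgebra.ι R (stdE R N j)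

/-- Telescoping differences of a sequence starting at `0` have the same exterior product as
the sequence itself. -/
theorem ExteriorAlgebra.prod_map_range_ι_sub_of_zero_left {R M : Type*} [CommRing R]
    [AddCommGroup M] [Module R M] (f : ℕ → M) (hf : f 0 = 0) (k : ℕ) :
    ((List.range k).map fun j => ι R (f (j + 1)) - ι R (f j)).prod
      = ((List.range k).map fun j => ι R (f (j + 1))).prod := by
  induction k with
  | zero => simp
  | succ k ih =>
    have hk : ((List.range k).map fun j => ι R (f (j + 1))).prod * ι R (f k) = 0 := by
      cases k with
      | zero => simp [hf]
      | succ k => simp [List.range_succ, mul_assoc]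
    rw [List.range_succ, List.map_append, List.prod_append, ih, List.map_append, List.prod_append]
    simp [mul_sub, hk]

/-- Telescoping differences of a sequence ending at `0` have, up to sign, the same exterior
product as the sequence itself. -/
theorem ExteriorAlgebra.prod_map_range_ι_sub_of_zero_right {R M : Type*} [CommRing R]
    [AddCommGroup M] [Module R M] (m : ℕ) (g : ℕ → M) (hg : g m = 0) :
    ((List.range m).map fun i => ι R (g (i + 1)) - ι R (g i)).prod
      = (-1 : R) ^ m • ((List.range m).map fun i => ι R (g i)).prod := by
  induction m generalizing g with
  | zero => simp
  | succ m ih =>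
    have hm : ι R (g 1) * ((List.range m).map fun i => ι R (g (i + 1))).prod = 0 := by
      cases m with
      | zero => simp [hg]
      | succ m => simp [List.range_succ_eq_map, ← mul_assoc]
    have h := ih (fun i => g (i + 1)) hg
    simp only [List.range_succ_eq_map, List.map_cons, List.map_map, List.prod_cons,
      Function.comp_def, Nat.succ_eq_add_one, zero_add]
    rw [h, mul_smul_comm, sub_mul, hm, zero_sub, pow_succ, mul_smul, neg_one_smul]

theorem List.filter_ne_range_add_succ (r m : ℕ) :
    (List.range (r + m + 1)).filter (fun j => decide (j ≠ r))
      = List.range r ++ (List.range m).map (r + 1 + ·) := by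
  have hl : (List.range r).filter (fun j => decide (j ≠ r)) = List.range r :=
    List.filter_eq_self.2 fun a ha => by simpa using (List.mem_range.1 ha).ne
  have hr : ((List.range m).map (r + 1 + ·)).filter (fun j => decide (j ≠ r))
      = (List.range m).map (r + 1 + ·) :=
    List.filter_eq_self.2 fun a ha => by
      obtain ⟨i, -, rfl⟩ := List.mem_map.1 ha
      exact decide_eq_true (by omega)
  rw [show r + m + 1 = r + 1 + m by omega, List.range_add, List.range_succ, List.filter_append,
    List.filter_append, hl, hr]
  simp

/-- For `0 ≤ r ≤ N`, the product `ω₀ ω₁ ⋯ ω̂_r ⋯ ω_N` (the factor `ω_r` omitted,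
remaining factors in increasing order of `j`) equals
`(−1)^{N−r} · ι(e₁) ι(e₂) ⋯ ι(e_N)` in `Λ(R^N)`. -/
theorem omega_prod_omit (R : Type*) [CommRing R] (N r : ℕ) (hr : r ≤ N) :
    (((List.range (N + 1)).filter (fun j => decide (j ≠ r))).map (omegaE R N)).prod
      = (-1 : R) ^ (N - r) •
          (((List.range N).map (fun j => ExteriorAlgebra.ι R (stdE R N (j + 1)))).prod) := by
  obtain ⟨m, rfl⟩ := Nat.exists_eq_add_of_le hr
  have hpre := ExteriorAlgebra.prod_map_range_ι_sub_of_zero_left (R := R) (stdE R (r + m))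
    (by simp [stdE]) r
  have hsuf := ExteriorAlgebra.prod_map_range_ι_sub_of_zero_right (R := R) m
    (fun i => stdE R (r + m) (r + 1 + i)) (by simp only [stdE]; rw [dif_neg (by omega)])
  have hidx : ∀ i, r + i + 1 = r + 1 + i := fun i => by omega
  have hω : omegaE R (r + m) = fun j => ExteriorAlgebra.ι R (stdE R (r + m) (j + 1))
      - ExteriorAlgebra.ι R (stdE R (r + m) j) := rfl
  rw [List.filter_ne_range_add_succ, hω]
  simp only [List.range_add, List.map_append, List.prod_append,
    List.map_map, Function.comp_def, Nat.add_sub_cancel_left, hidx]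
  simp only [← add_assoc] at hsuf
  rw [hpre, hsuf, mul_smul_comm]
end

section
/- Define P_t(A,B) := ε·α₃ ⊠ (t·β₁ + (1−t)·β₂) + ((1−t)·α₁ + t·α₂) ⊠ β₃, P_t(D̂A, B) := ε·(α₂ − α₁ − Dα₃) ⊠ (t·β₁ + (1−t)·β₂) + ((1−t)·Dα₁ + t·Dα₂) ⊠ β₃, and P_t(A, D̂B) := −ε·α₃ ⊠ (t·Dβ₁ + (1−t)·Dβ₂) + ((1−t)·α₁ + t·α₂) ⊠ (β₂ − β₁ − Dβ₃). Then D(P_t(A,B)) + ε·P_t(D̂A,B) + P_t(A,D̂B) = α₂ ⊠ β₂ − α₁ ⊠ β₁. (This is the key identity showing that the pairing ⊠̂_t on the shifted cone complexes ℤ*_Π(k|∞) is a morphism of complexes.) -/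
/-- The key identity showing that the pairing `⊠̂_t` on the shifted cone complexes
`ℤ*_Π(k|∞)` is a morphism of complexes: with `ε = (−1)^s`,
`D(P_t(A,B)) + ε·P_t(D̂A,B) + P_t(A,D̂B) = α₂ ⊠ β₂ − α₁ ⊠ β₁`,
where `B` denotes the bilinear pairing `⊠` and `D` the (linear) total differential,
subject to the signed Leibniz rules for `⊠` against `β₁, β₂` (degree `s`) and
`β₃` (degree `s−1`). -/
theorem cone_pairing_identity {M : Type*} [AddCommGroup M] [Module ℂ M]
    (B : M →ₗ[ℂ] M →ₗ[ℂ] M) (D : M →ₗ[ℂ] M) (t : ℂ) (s : ℤ)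
    (α₁ α₂ α₃ β₁ β₂ β₃ : M)
    (hβ₁ : ∀ x : M, D (B x β₁) = ((-1 : ℂ) ^ s) • B (D x) β₁ + B x (D β₁))
    (hβ₂ : ∀ x : M, D (B x β₂) = ((-1 : ℂ) ^ s) • B (D x) β₂ + B x (D β₂))
    (hβ₃ : ∀ x : M, D (B x β₃) = -(((-1 : ℂ) ^ s) • B (D x) β₃) + B x (D β₃)) :
    D (((-1 : ℂ) ^ s) • B α₃ (t • β₁ + (1 - t) • β₂) + B ((1 - t) • α₁ + t • α₂) β₃)
      + ((-1 : ℂ) ^ s) •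
          (((-1 : ℂ) ^ s) • B (α₂ - α₁ - D α₃) (t • β₁ + (1 - t) • β₂)
            + B ((1 - t) • D α₁ + t • D α₂) β₃)
      + (-(((-1 : ℂ) ^ s) • B α₃ (t • D β₁ + (1 - t) • D β₂))
          + B ((1 - t) • α₁ + t • α₂) (β₂ - β₁ - D β₃))
      = B α₂ β₂ - B α₁ β₁ := by
  have hε : ((-1 : ℂ) ^ s) * ((-1 : ℂ) ^ s) = 1 := by
    rw [← mul_zpow]; norm_num
  generalize (-1 : ℂ) ^ s = ε at *
  simp only [map_add, map_sub, map_smul, LinearMap.add_apply, LinearMap.sub_apply,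
    LinearMap.smul_apply, hβ₁, hβ₂, hβ₃, smul_add, smul_sub, smul_neg]
  match_scalars <;> grind
end

section
/- For p = 2r+1 with r ≥ 0, the kernel of δ̂_p : V_p → V_{p+1} is the ℂ-span of {x^{2j} − x^{2j−1} : 1 ≤ j ≤ r}, and the range of δ̂_p is the ℂ-span of the even monomials {1, x², x⁴, …, x^{2r}, x^{2r+2}}. -/
noncomputable section

open Polynomial

/-- `τ(m) = 1` if `m` is odd, `0` if `m` is even (as a complex scalar). -/
def tauC (m : ℕ) : ℂ := if Odd m then 1 else 0

/-- The `E₁`-differential `δ̂_p`: the `ℂ`-linear map on polynomials defined on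
monomials by `δ̂_p(x^a) = (−1)^p τ(a) x^{a+1} + (−1)^{p−a} τ(p−a) x^a`. -/
def delHat (p : ℕ) : Polynomial ℂ →ₗ[ℂ] Polynomial ℂ :=
  (Polynomial.basisMonomials ℂ).constr ℂ fun a =>
    ((-1 : ℂ) ^ p * tauC a) • (X : Polynomial ℂ) ^ (a + 1)
      + ((-1 : ℂ) ^ (p - a) * tauC (p - a)) • (X : Polynomial ℂ) ^ a

theorem delHat_X_pow (p a : ℕ) :
    delHat p (X ^ a) = ((-1 : ℂ) ^ p * tauC a) • (X : Polynomial ℂ) ^ (a + 1)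
      + ((-1 : ℂ) ^ (p - a) * tauC (p - a)) • (X : Polynomial ℂ) ^ a := by
  have h : (X : Polynomial ℂ) ^ a = basisMonomials ℂ a := by
    simp [coe_basisMonomials, monomial_one_right_eq_X_pow]
  conv_lhs => rw [h]
  exact (basisMonomials ℂ).constr_basis ℂ _ a

theorem delHat_X_pow_of_odd {p a : ℕ} (hp : Odd p) (ha : Odd a) :
    delHat p (X ^ a) = -(X : Polynomial ℂ) ^ (a + 1) := by
  have h : ¬ Odd (p - a) := by
    rw [Nat.not_odd_iff_even]
    exact Nat.Odd.sub_odd hp ha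
  simp [delHat_X_pow, tauC, ha, h, hp.neg_one_pow]

theorem delHat_X_pow_of_even {p a : ℕ} (hp : Odd p) (ha : Even a) (hap : a ≤ p) :
    delHat p (X ^ a) = -(X : Polynomial ℂ) ^ a := by
  have h : Odd (p - a) := Nat.Odd.sub_even hap hp ha
  simp [delHat_X_pow, tauC, Nat.not_odd_iff_even.mpr ha, h, h.neg_one_pow]

theorem degreeLE_eq_span_X_pow_le (n : ℕ) :
    degreeLE ℂ (n : WithBot ℕ) = Submodule.span ℂ {g | ∃ a : ℕ, a ≤ n ∧ g = X ^ a} := by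
  rw [degreeLE_eq_span_X_pow]
  congr 1
  ext g
  simp [eq_comm]

theorem X_pow_mem_degreeLE {a n : ℕ} (h : a ≤ n) :
    (X : Polynomial ℂ) ^ a ∈ degreeLE ℂ (n : WithBot ℕ) := by
  rw [degreeLE_eq_span_X_pow_le]
  exact Submodule.subset_span ⟨a, h, rfl⟩

/-- Modulo the span of the differences `x^{2j} − x^{2j−1}`, a polynomial `f` of degree at most
`2r+1` is determined by `δ̂ f`. -/
theorem add_delHat_sub_mem_span (r : ℕ) {f : Polynomial ℂ}
    (hf : f ∈ degreeLE ℂ ((2 * r + 1 : ℕ) : WithBot ℕ)) :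
    f + delHat (2 * r + 1) f
        - (delHat (2 * r + 1) f).coeff (2 * r + 2) • (X ^ (2 * r + 2) - X ^ (2 * r + 1))
      ∈ Submodule.span ℂ
          {g : Polynomial ℂ | ∃ j : ℕ, 1 ≤ j ∧ j ≤ r ∧
            g = (X : Polynomial ℂ) ^ (2 * j) - (X : Polynomial ℂ) ^ (2 * j - 1)} := by
  have hp : Odd (2 * r + 1) := odd_two_mul_add_one r
  rw [degreeLE_eq_span_X_pow_le] at hf
  induction hf using Submodule.span_induction with
  | zero => simp
  | add f g _ _ hf hg =>
    convert add_mem hf hg using 1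
    simp only [map_add, coeff_add, add_smul]
    abel
  | smul c f _ hf =>
    convert Submodule.smul_mem _ c hf using 1
    simp only [map_smul, coeff_smul, smul_sub, smul_add, smul_assoc]
  | mem f hf =>
    obtain ⟨a, ha, rfl⟩ := hf
    rcases Nat.even_or_odd a with h | h
    · rw [delHat_X_pow_of_even hp h ha, coeff_neg, coeff_X_pow, if_neg (by omega)]
      simp
    · rw [delHat_X_pow_of_odd hp h, coeff_neg, coeff_X_pow]
      obtain ⟨k, rfl⟩ := h
      rcases eq_or_ne k r with rfl | hk
      · simp
      · rw [if_neg (by omega), neg_zero, zero_smul, sub_zero, ← sub_eq_add_neg, ← neg_sub]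
        exact neg_mem (Submodule.subset_span ⟨k + 1, by omega, by omega, rfl⟩)

/-- For `p = 2r+1`, the kernel of `δ̂_p : V_p → V_{p+1}` is spanned by
`{x^{2j} − x^{2j−1} : 1 ≤ j ≤ r}`, and its range is spanned by the even monomials
`{1, x², x⁴, …, x^{2r}, x^{2r+2}}`. -/
theorem delHat_odd_ker_range (r : ℕ) :
    Polynomial.degreeLE ℂ ((2 * r + 1 : ℕ) : WithBot ℕ) ⊓ LinearMap.ker (delHat (2 * r + 1))
        = Submodule.span ℂ
            {g : Polynomial ℂ | ∃ j : ℕ, 1 ≤ j ∧ j ≤ r ∧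
              g = (X : Polynomial ℂ) ^ (2 * j) - (X : Polynomial ℂ) ^ (2 * j - 1)}
      ∧ Submodule.map (delHat (2 * r + 1))
          (Polynomial.degreeLE ℂ ((2 * r + 1 : ℕ) : WithBot ℕ))
        = Submodule.span ℂ
            {g : Polynomial ℂ | ∃ a : ℕ, Even a ∧ a ≤ 2 * r + 2 ∧
              g = (X : Polynomial ℂ) ^ a} := by
  have hp : Odd (2 * r + 1) := odd_two_mul_add_one r
  refine ⟨le_antisymm ?_ ?_, le_antisymm ?_ ?_⟩
  · rintro f ⟨hf, hker⟩
    have h := add_delHat_sub_mem_span r hf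
    rw [LinearMap.mem_ker.mp hker] at h
    simpa using h
  · rw [Submodule.span_le]
    rintro _ ⟨j, hj, hjr, rfl⟩
    have hodd : Odd (2 * j - 1) := Nat.Even.sub_odd (by omega) (even_two_mul j) odd_one
    refine ⟨sub_mem (X_pow_mem_degreeLE (by omega)) (X_pow_mem_degreeLE (by omega)), ?_⟩
    rw [SetLike.mem_coe, LinearMap.mem_ker, map_sub,
      delHat_X_pow_of_even hp (even_two_mul j) (by omega), delHat_X_pow_of_odd hp hodd,
      Nat.sub_add_cancel (by omega), sub_self]
  · rw [degreeLE_eq_span_X_pow_le, Submodule.map_span, Submodule.span_le]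
    rintro _ ⟨_, ⟨a, ha, rfl⟩, rfl⟩
    rcases Nat.even_or_odd a with h | h
    · rw [delHat_X_pow_of_even hp h ha]
      exact neg_mem (Submodule.subset_span ⟨a, h, by omega, rfl⟩)
    · rw [delHat_X_pow_of_odd hp h]
      exact neg_mem (Submodule.subset_span ⟨a + 1, h.add_one, by omega, rfl⟩)
  · rw [Submodule.span_le]
    rintro _ ⟨a, ha, har, rfl⟩
    rcases Nat.lt_or_ge (2 * r + 1) a with h | h
    · obtain rfl : a = 2 * r + 1 + 1 := by omega
      refine ⟨-X ^ (2 * r + 1), neg_mem (X_pow_mem_degreeLE le_rfl), ?_⟩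
      rw [map_neg, delHat_X_pow_of_odd hp hp, neg_neg]
    · refine ⟨-X ^ a, neg_mem (X_pow_mem_degreeLE h), ?_⟩
      rw [map_neg, delHat_X_pow_of_even hp ha h, neg_neg]
end
end
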